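/- Let M = p²q²r² with p < q < r primes, and let A, B ⊆ ℤ_M satisfy A ⊕ B = ℤ_M, |A| = |B| = pqr, 0 ∈ A ∩ B, neither contained in a proper subgroup, and 1 ∉ Div(B). Then Φ_p(x)·Φ_q(x)·Φ_r(x) divides A(x). -/

import Mathlib

open Finset Polynomial

/-- `A ⊕ B = ℤ_M`: unique representation of every element as `a + b`. -/
def Tiles {M : ℕ} (A B : Finset (ZMod M)) : Prop :=
  ∀ g : ZMod M, ∃! ab : ZMod M × ZMod M, ab.1 ∈ A ∧ ab.2 ∈ B ∧ ab.1 + ab.2 = g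

/-- The division set `Div(E) = {gcd(a - a', M) : a, a' ∈ E}`. -/
def DivSet {M : ℕ} (E : Finset (ZMod M)) : Set ℕ :=
  {d | ∃ a ∈ E, ∃ b ∈ E, Nat.gcd ((a - b).val) M = d}

/-- `E` is not contained in any proper subgroup `dℤ_M` (`d ∣ M`, `d > 1`). -/
def NotInProperSubgroup {M : ℕ} (E : Finset (ZMod M)) : Prop :=
  ∀ d : ℕ, d ∣ M → 1 < d → ∃ x ∈ E, ¬ d ∣ x.val

/-- The mask polynomial `E(x) = Σ_{a ∈ E} x^a`, representatives in `{0, …, M-1}`. -/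
noncomputable def maskPoly {M : ℕ} (E : Finset (ZMod M)) : Polynomial ℤ :=
  ∑ a ∈ E, X ^ a.val

/-- `f(n) = s·[n ≡ c mod s^(e+1)] - [n ≡ c mod s^e]`. -/
def ff (s e c n : ℕ) : ℤ :=
  s * (if n % s ^ (e + 1) = c % s ^ (e + 1) then 1 else 0) - (if n % s ^ e = c % s ^ e then 1 else 0)

lemma geom_ind {N : ℕ} (hN : 0 < N) {z : ℂ} (hz : IsPrimitiveRoot z N) (n c : ℕ) :
    ∑ k ∈ range N, (z ^ n * (z⁻¹) ^ c) ^ k = if n % N = c % N then (N : ℂ) else 0 := by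
  have hz0 : z ≠ 0 := hz.ne_zero hN.ne'
  have key : z ^ n * (z⁻¹) ^ c = 1 ↔ n % N = c % N := by
    rw [inv_pow, mul_inv_eq_one₀ (pow_ne_zero _ hz0), (hz.isOfFinOrder hN.ne').pow_inj_mod, ← hz.eq_orderOf]
  split_ifs with h
  · rw [key.2 h]; simp
  · have h1 : z ^ n * (z⁻¹) ^ c ≠ 1 := fun h' => h (key.1 h')
    rw [geom_sum_eq h1]
    have : (z ^ n * (z⁻¹) ^ c) ^ N = 1 := by
      rw [mul_pow, ← pow_mul, ← pow_mul, mul_comm n, mul_comm c, pow_mul, pow_mul, inv_pow,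
        hz.pow_eq_one]; simp
    rw [this]; simp

lemma ff_eq {s : ℕ} (hs : s.Prime) (e : ℕ) {z : ℂ} (hz : IsPrimitiveRoot z (s ^ (e + 1))) (n c : ℕ) :
    (s : ℂ) ^ e * (ff s e c n : ℂ) =
      ∑ k ∈ (range (s ^ (e + 1))).filter (fun k => ¬ s ∣ k), (z ^ k) ^ n * ((z ^ k)⁻¹) ^ c := by
  have hs0 := hs.pos
  have h1 := geom_ind (pow_pos hs0 (e + 1)) hz n c
  have hzs : IsPrimitiveRoot (z ^ s) (s ^ e) := hz.pow (pow_pos hs0 _) (by rw [pow_succ, mul_comm])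
  have h2 := geom_ind (pow_pos hs0 e) hzs n c
  rw [← sum_filter_add_sum_filter_not _ (fun k => s ∣ k)] at h1
  have h3 : ∑ k ∈ (range (s ^ (e + 1))).filter (fun k => s ∣ k), (z ^ n * (z⁻¹) ^ c) ^ k
      = ∑ k ∈ range (s ^ e), ((z ^ s) ^ n * ((z ^ s)⁻¹) ^ c) ^ k := by
    symm
    apply sum_nbij' (fun k => s * k) (fun k => k / s)
    · intro k hk
      simp only [mem_filter, mem_range] at hk ⊢
      refine ⟨?_, dvd_mul_right _ _⟩
      rw [pow_succ, mul_comm]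
      exact Nat.mul_lt_mul_of_pos_right hk hs0
    · intro k hk
      simp only [mem_filter, mem_range] at hk ⊢
      rw [pow_succ] at hk
      exact Nat.div_lt_of_lt_mul (by rw [mul_comm]; exact hk.1)
    · intro k hk; exact Nat.mul_div_cancel_left _ hs0
    · intro k hk
      simp only [mem_filter] at hk
      exact Nat.mul_div_cancel' hk.2
    · intro k hk
      rw [← inv_pow, ← pow_mul, ← pow_mul, mul_comm s n, mul_comm s c, pow_mul, pow_mul, ← mul_pow,
        ← pow_mul]
  rw [h3, h2] at h1
  have h4 : ∑ k ∈ (range (s ^ (e + 1))).filter (fun k => ¬ s ∣ k), (z ^ k) ^ n * ((z ^ k)⁻¹) ^ c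
    = ∑ k ∈ (range (s ^ (e + 1))).filter (fun k => ¬ s ∣ k), (z ^ n * (z⁻¹) ^ c) ^ k := by
    apply sum_congr rfl
    intro k _
    rw [← inv_pow, ← pow_mul, ← pow_mul, mul_comm k n, mul_comm k c, pow_mul, pow_mul, ← mul_pow]
  rw [h4, eq_sub_of_add_eq' h1, ff]
  push_cast
  split_ifs <;> ring

lemma sum_ff {ι : Type*} (E : Finset ι) (v : ι → ℕ) (w : ι → ℂ) {s : ℕ} (hs : s.Prime) (e c : ℕ)
    (h : ∀ z : ℂ, IsPrimitiveRoot z (s ^ (e + 1)) → ∑ x ∈ E, w x * z ^ v x = 0) :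
    ∑ x ∈ E, w x * (ff s e c (v x) : ℂ) = 0 := by
  have hs0 : (s : ℂ) ^ e ≠ 0 := pow_ne_zero _ (by exact_mod_cast hs.ne_zero)
  have hz := Complex.isPrimitiveRoot_exp (s ^ (e + 1)) (pow_ne_zero _ hs.ne_zero)
  set z := Complex.exp (2 * Real.pi * Complex.I / ((s ^ (e + 1) : ℕ) : ℂ))
  apply mul_left_cancel₀ hs0
  rw [mul_zero, mul_sum]
  have : ∀ x ∈ E, (s : ℂ) ^ e * (w x * (ff s e c (v x) : ℂ)) =
      ∑ k ∈ (range (s ^ (e + 1))).filter (fun k => ¬ s ∣ k), w x * (z ^ k) ^ v x * ((z ^ k)⁻¹) ^ c := by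
    intro x _
    rw [mul_left_comm, ff_eq hs e hz, mul_sum]
    simp only [mul_assoc]
  rw [sum_congr rfl this, sum_comm]
  apply sum_eq_zero
  intro k hk
  rw [← sum_mul, h, zero_mul]
  apply hz.pow_of_coprime
  simp only [mem_filter] at hk
  exact Nat.Coprime.pow_right _ ((Nat.Prime.coprime_iff_not_dvd hs).2 hk.2).symm

/-- evaluation of the mask polynomial -/
noncomputable def evE {M : ℕ} (E : Finset (ZMod M)) (z : ℂ) : ℂ := ∑ x ∈ E, z ^ x.val

/-- vanishing at all primitive `n`-th roots of unity -/
def ZZ {M : ℕ} (E : Finset (ZMod M)) (n : ℕ) : Prop := ∀ z : ℂ, IsPrimitiveRoot z n → evE E z = 0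

lemma prim_mul {a b : ℕ} (hab : a.Coprime b) {y z : ℂ} (hy : IsPrimitiveRoot y a)
    (hz : IsPrimitiveRoot z b) : IsPrimitiveRoot (y * z) (a * b) := by
  have := (Commute.all y z).orderOf_mul_eq_mul_orderOf_of_coprime
    (by rw [← hy.eq_orderOf, ← hz.eq_orderOf]; exact hab)
  rw [← hy.eq_orderOf, ← hz.eq_orderOf] at this
  rw [← this]; exact IsPrimitiveRoot.orderOf _

lemma ff1 {M : ℕ} (E : Finset (ZMod M)) {s : ℕ} (hs : s.Prime) (e c : ℕ) (h : ZZ E (s ^ (e + 1))) :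
    ∑ x ∈ E, ff s e c x.val = 0 := by
  have := sum_ff E ZMod.val (fun _ => 1) hs e c (fun z hz => by simpa [evE] using h z hz)
  simp only [one_mul] at this
  exact_mod_cast this

lemma ff2 {M : ℕ} (E : Finset (ZMod M)) {s t : ℕ} (hs : s.Prime) (ht : t.Prime) (hst : s ≠ t)
    (e c e' c' : ℕ) (h : ZZ E (s ^ (e + 1) * t ^ (e' + 1))) :
    ∑ x ∈ E, ff s e c x.val * ff t e' c' x.val = 0 := by
  have co : (s ^ (e + 1)).Coprime (t ^ (e' + 1)) :=
    Nat.Coprime.pow _ _ ((Nat.coprime_primes hs ht).2 hst)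
  have := sum_ff E ZMod.val (fun x => (ff s e c x.val : ℂ)) ht e' c' (fun z hz => by
    have := sum_ff E ZMod.val (fun x => z ^ x.val) hs e c (fun y hy => by
      have := h _ (prim_mul co hy hz)
      rw [evE] at this
      rw [← this]
      exact sum_congr rfl fun x _ => by rw [mul_pow, mul_comm])
    rw [← this]
    exact sum_congr rfl fun x _ => mul_comm _ _)
  exact_mod_cast this

lemma ff3 {M : ℕ} (E : Finset (ZMod M)) {s t u : ℕ} (hs : s.Prime) (ht : t.Prime) (hu : u.Prime)
    (hst : s ≠ t) (hsu : s ≠ u) (htu : t ≠ u)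
    (e c e' c' e'' c'' : ℕ) (h : ZZ E (s ^ (e + 1) * t ^ (e' + 1) * u ^ (e'' + 1))) :
    ∑ x ∈ E, ff s e c x.val * ff t e' c' x.val * ff u e'' c'' x.val = 0 := by
  have co : (s ^ (e + 1)).Coprime (t ^ (e' + 1)) :=
    Nat.Coprime.pow _ _ ((Nat.coprime_primes hs ht).2 hst)
  have co1 : (s ^ (e + 1)).Coprime (u ^ (e'' + 1)) :=
    Nat.Coprime.pow _ _ ((Nat.coprime_primes hs hu).2 hsu)
  have co2 : (t ^ (e' + 1)).Coprime (u ^ (e'' + 1)) :=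
    Nat.Coprime.pow _ _ ((Nat.coprime_primes ht hu).2 htu)
  have := sum_ff E ZMod.val (fun x => (ff s e c x.val : ℂ) * (ff t e' c' x.val : ℂ)) hu e'' c''
    (fun z hz => by
    have := sum_ff E ZMod.val (fun x => (ff s e c x.val : ℂ) * z ^ x.val) ht e' c' (fun y hy => by
      have := sum_ff E ZMod.val (fun x => y ^ x.val * z ^ x.val) hs e c (fun y' hy' => by
        have := h _ (prim_mul (Nat.Coprime.mul_left co1 co2) (prim_mul co hy' hy) hz)
        rw [evE] at this
        rw [← this]
        exact sum_congr rfl fun x _ => by rw [mul_pow, mul_pow]; ring)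
      rw [← this]
      exact sum_congr rfl fun x _ => by ring)
    rw [← this]
    exact sum_congr rfl fun x _ => by ring)
  exact_mod_cast this

lemma aeval_mask {M : ℕ} (E : Finset (ZMod M)) (z : ℂ) : aeval z (maskPoly E) = evE E z := by
  simp [maskPoly, evE]

lemma cyc_dvd {M : ℕ} (E : Finset (ZMod M)) {n : ℕ} (hn : 0 < n) {z : ℂ} (hz : IsPrimitiveRoot z n)
    (h : evE E z = 0) : cyclotomic n ℤ ∣ maskPoly E := by
  rw [cyclotomic_eq_minpoly hz hn]
  apply minpoly.isIntegrallyClosed_dvd (hz.isIntegral hn)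
  rw [aeval_mask, h]

lemma ZZ_of {M : ℕ} (E : Finset (ZMod M)) {n : ℕ} (hn : 0 < n) {z : ℂ} (hz : IsPrimitiveRoot z n)
    (h : evE E z = 0) : ZZ E n := by
  intro y hy
  obtain ⟨g, hg⟩ := cyc_dvd E hn hz h
  rw [← aeval_mask, hg, map_mul, cyclotomic_eq_minpoly hy hn, minpoly.aeval, zero_mul]

lemma tile_or {M : ℕ} (hM : 0 < M) (A B : Finset (ZMod M)) (hT : Tiles A B) (n : ℕ) (hn : n ∣ M)
    (hn1 : n ≠ 1) : ZZ A n ∨ ZZ B n := by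
  have : NeZero M := ⟨hM.ne'⟩
  have hn0 : 0 < n := Nat.pos_of_dvd_of_pos hn hM
  have hz := Complex.isPrimitiveRoot_exp n hn0.ne'
  set z := Complex.exp (2 * Real.pi * Complex.I / (n : ℂ))
  have hzM : z ^ M = 1 := by
    obtain ⟨k, rfl⟩ := hn
    rw [pow_mul, hz.pow_eq_one, one_pow]
  have hz1 : z ≠ 1 := hz.ne_one (by omega)
  have hadd : ∀ a b : ZMod M, z ^ (a + b).val = z ^ a.val * z ^ b.val := by
    intro a b
    rw [ZMod.val_add, ← pow_add]
    conv_rhs => rw [← Nat.div_add_mod (a.val + b.val) M, pow_add, pow_mul, hzM, one_pow, one_mul]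
  have hsum : ∑ g : ZMod M, z ^ g.val = 0 := by
    have : ∑ g : ZMod M, z ^ g.val = ∑ k ∈ range M, z ^ k := by
      apply sum_nbij' (fun g : ZMod M => g.val) (fun k : ℕ => (k : ZMod M))
      · intro g _; simpa using ZMod.val_lt g
      · intro k _; simp
      · intro g _; simp
      · intro k hk; exact ZMod.val_cast_of_lt (by simpa using hk)
      · intro g _; rfl
    rw [this, geom_sum_eq hz1, hzM]; simp
  have hprod : evE A z * evE B z = 0 := by
    rw [← hsum, evE, evE, sum_mul_sum, ← sum_product']
    apply sum_bij (fun ab _ => ab.1 + ab.2)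
    · intro a _; simp
    · intro a ha b hb hab
      simp only [mem_product] at ha hb
      exact (hT (a.1 + a.2)).unique ⟨ha.1, ha.2, rfl⟩ ⟨hb.1, hb.2, hab.symm⟩
    · intro g _
      obtain ⟨ab, ⟨h1, h2, h3⟩, _⟩ := hT g
      exact ⟨ab, mem_product.2 ⟨h1, h2⟩, h3⟩
    · intro a _; exact (hadd _ _).symm
  rcases mul_eq_zero.1 hprod with h | h
  · exact Or.inl (ZZ_of A hn0 hz h)
  · exact Or.inr (ZZ_of B hn0 hz h)

/-- combinatorics of intersecting families of triples -/
lemma comb_aux {ι : Type*} (B : Finset ι) (α β γ : ι → ℕ)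
    (hint : ∀ x ∈ B, ∀ y ∈ B, α x = α y ∨ β x = β y ∨ γ x = γ y)
    (hγ : ∀ c, ∃ x ∈ B, γ x ≠ c)
    (x y : ι) (hx : x ∈ B) (hy : y ∈ B) (hxy : α x ≠ α y) (hb : β x ≠ β y) :
    (∃ k0 b0 c0, (∃ x ∈ B, α x = k0 ∧ β x ≠ b0) ∧ (∃ x ∈ B, α x = k0 ∧ γ x ≠ c0) ∧ 
       (∀ x ∈ B, α x ≠ k0 → β x = b0 ∧ γ x = c0)) ∨
    (∃ k0 k1 b0 b1 c0 c1, k0 ≠ k1 ∧ b0 ≠ b1 ∧ c0 ≠ c1 ∧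
      (∃ x ∈ B, α x = k1 ∧ β x = b0 ∧ γ x = c0) ∧ (∃ x ∈ B, α x = k1 ∧ β x = b1 ∧ γ x = c1) ∧
      (∀ x ∈ B, (α x = k1 ∧ β x = b0 ∧ γ x = c0) ∨ (α x = k1 ∧ β x = b1 ∧ γ x = c1) ∨
        (α x = k0 ∧ β x = b0 ∧ γ x = c1) ∨ (α x = k0 ∧ β x = b1 ∧ γ x = c0))) := by
  have hg : γ x = γ y := by have := hint x hx y hy; tauto
  obtain ⟨z, hz, hzc⟩ := hγ (γ x)
  have a1 := hint z hz x hx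
  have a2 := hint z hz y hy
  have h0 : (α z = α x ∧ β z = β y) ∨ (α z = α y ∧ β z = β x) := by grind
  have : ∃ x y : ι, x ∈ B ∧ y ∈ B ∧ α x ≠ α y ∧ β x ≠ β y ∧ γ x = γ y ∧ γ z ≠ γ x ∧
      α z = α x ∧ β z = β y := by
    rcases h0 with ⟨h1, h2⟩ | ⟨h1, h2⟩
    · exact ⟨x, y, hx, hy, hxy, hb, hg, hzc, h1, h2⟩
    · exact ⟨y, x, hy, hx, hxy.symm, hb.symm, hg.symm, (by rw [← hg]; exact hzc), h1, h2⟩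
  clear h0 a1 a2 hzc hg hb hxy hx hy x y
  obtain ⟨x, y, hx, hy, hxy, hb, hg, hzc, hza, hzb⟩ := this
  by_cases H : ∀ w ∈ B, α w ≠ α x → β w = β y ∧ γ w = γ y
  · left
    exact ⟨α x, β y, γ y, ⟨x, hx, rfl, hb⟩, ⟨z, hz, hza, by rw [← hg]; exact hzc⟩, H⟩
  · right
    push Not at H
    obtain ⟨w, hw, hwa, hw2⟩ := H
    have a1 := hint w hw x hx
    have a2 := hint w hw y hy
    have a3 := hint w hw z hz
    have hw3 : β w = β x ∧ γ w = γ z ∧ α w = α y := by grind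
    refine ⟨α x, α y, β y, β x, γ y, γ z, hxy, hb.symm, by grind, ⟨y, hy, rfl, rfl, rfl⟩,
      ⟨w, hw, by grind⟩, ?_⟩
    intro v hv
    have b1 := hint v hv x hx
    have b2 := hint v hv y hy
    have b3 := hint v hv z hz
    have b4 := hint v hv w hw
    grind

lemma comb {ι : Type*} (B : Finset ι) (α β γ : ι → ℕ)
    (hint : ∀ x ∈ B, ∀ y ∈ B, α x = α y ∨ β x = β y ∨ γ x = γ y)
    (hα : ∀ c, ∃ x ∈ B, α x ≠ c)
    (hβ : ∀ c, ∃ x ∈ B, β x ≠ c)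
    (hγ : ∀ c, ∃ x ∈ B, γ x ≠ c) :
    (∃ k0 b0 c0, (∃ x ∈ B, α x = k0 ∧ β x ≠ b0) ∧ (∃ x ∈ B, α x = k0 ∧ γ x ≠ c0) ∧ 
       (∀ x ∈ B, α x ≠ k0 → β x = b0 ∧ γ x = c0)) ∨
    (∃ k0 k1 b0 b1 c0 c1, k0 ≠ k1 ∧ b0 ≠ b1 ∧ c0 ≠ c1 ∧
      (∃ x ∈ B, α x = k1 ∧ β x = b0 ∧ γ x = c0) ∧ (∃ x ∈ B, α x = k1 ∧ β x = b1 ∧ γ x = c1) ∧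
      (∀ x ∈ B, (α x = k1 ∧ β x = b0 ∧ γ x = c0) ∨ (α x = k1 ∧ β x = b1 ∧ γ x = c1) ∨
        (α x = k0 ∧ β x = b0 ∧ γ x = c1) ∨ (α x = k0 ∧ β x = b1 ∧ γ x = c0))) := by
  by_cases H : ∃ x ∈ B, ∃ y ∈ B, α x ≠ α y ∧ β x ≠ β y
  · obtain ⟨x, hx, y, hy, h1, h2⟩ := H
    exact comb_aux B α β γ hint hγ x y hx hy h1 h2
  by_cases H' : ∃ x ∈ B, ∃ y ∈ B, α x ≠ α y ∧ γ x ≠ γ y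
  · obtain ⟨x, hx, y, hy, h1, h2⟩ := H'
    rcases comb_aux B α γ β (fun x hx y hy => by have := hint x hx y hy; tauto) hβ x y hx hy h1 h2
      with ⟨k0, b0, c0, h1, h2, h3⟩ | ⟨k0, k1, b0, b1, c0, c1, n1, n2, n3, w1, w2, h⟩
    · left
      exact ⟨k0, c0, b0, h2, h1, fun x hx hk => (h3 x hx hk).symm⟩
    · right
      refine ⟨k0, k1, c0, c1, b0, b1, n1, n3, n2, ?_, ?_, ?_⟩
      · obtain ⟨x, hx, h⟩ := w1; exact ⟨x, hx, by tauto⟩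
      · obtain ⟨x, hx, h⟩ := w2; exact ⟨x, hx, by tauto⟩
      · intro x hx; have := h x hx; tauto
  exfalso
  push Not at H H'
  obtain ⟨x, hx, -⟩ := hα 0
  obtain ⟨y, hy, hxy⟩ := hα (α x)
  obtain ⟨z, hz, hzx⟩ := hβ (β x)
  grind

/-- integer indicator -/
def J (P : Prop) [Decidable P] : ℤ := if P then 1 else 0

lemma ff_zero (s c n : ℕ) : ff s 0 c n = s * J (n % s = c % s) - 1 := by simp [ff, J, Nat.mod_one]

lemma ff_one (s c n : ℕ) : ff s 1 c n = s * J (n % s ^ 2 = c % s ^ 2) - J (n % s = c % s) := by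
  simp [ff, J]

lemma c1 {M : ℕ} (E : Finset (ZMod M)) {s : ℕ} (hs : s.Prime) (h : ZZ E s) (k : ℕ) :
    (s : ℤ) * ∑ x ∈ E, J (x.val % s = k % s) = E.card := by
  have := ff1 E hs 0 k (by simpa using h)
  simp only [ff_zero, sum_sub_distrib, ← mul_sum, sum_const, nsmul_eq_mul, mul_one] at this
  linarith

lemma c1sq {M : ℕ} (E : Finset (ZMod M)) {s : ℕ} (hs : s.Prime) (h : ZZ E (s ^ 2)) (k : ℕ) :
    (s : ℤ) ∣ ∑ x ∈ E, J (x.val % s = k % s) := by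
  have := ff1 E hs 1 k (by simpa using h)
  simp only [ff_one, sum_sub_distrib, ← mul_sum] at this
  exact ⟨_, (sub_eq_zero.1 this).symm⟩

lemma c2 {M : ℕ} (E : Finset (ZMod M)) {s t : ℕ} (hs : s.Prime) (ht : t.Prime) (hst : s ≠ t)
    (h : ZZ E (s * t)) (k c : ℕ) :
    (s : ℤ) * t * ∑ x ∈ E, J (x.val % s = k % s) * J (x.val % t = c % t)
      - s * ∑ x ∈ E, J (x.val % s = k % s) - t * ∑ x ∈ E, J (x.val % t = c % t) + E.card = 0 := by
  have := ff2 E hs ht hst 0 k 0 c (by simpa using h)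
  rw [← this, mul_sum, mul_sum, mul_sum, card_eq_sum_ones, Nat.cast_sum, ← sum_sub_distrib,
    ← sum_sub_distrib, ← sum_add_distrib]
  apply sum_congr rfl
  intro x _
  rw [ff_zero, ff_zero]
  push_cast
  ring

lemma not_both {M : ℕ} (E : Finset (ZMod M)) {s t u : ℕ} (hs : s.Prime) (ht : t.Prime)
    (hu : u.Prime) (hst : s ≠ t) (hsu : s ≠ u) (hE : E.card = s * t * u) (h1 : ZZ E s)
    (h2 : ZZ E (s ^ 2)) : False := by
  have a := c1 E hs h1 0
  obtain ⟨m, hm⟩ := c1sq E hs h2 0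
  rw [hm, hE] at a
  push_cast at a
  have hs0 : (s : ℤ) ≠ 0 := by exact_mod_cast hs.ne_zero
  have : (s : ℤ) * m = t * u := by
    apply mul_left_cancel₀ hs0
    linarith
  have h3 : (s : ℤ) ∣ ((t * u : ℕ) : ℤ) := ⟨m, by push_cast; exact this.symm⟩
  have h4 : s ∣ t * u := by exact_mod_cast h3
  rcases (Nat.Prime.dvd_mul hs).1 h4 with h | h
  · exact hst ((Nat.prime_dvd_prime_iff_eq hs ht).1 h)
  · exact hsu ((Nat.prime_dvd_prime_iff_eq hs hu).1 h)

lemma fin_lem {M : ℕ} (A : Finset (ZMod M)) {s t u : ℕ} (hs : s.Prime) (ht : t.Prime)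
    (hu : u.Prime) (hst : s ≠ t) (hsu : s ≠ u) (htu : t ≠ u) (hA : A.card = s * t * u)
    (h0 : (0 : ZMod M) ∈ A) (hsub : ∃ x ∈ A, ¬ s ∣ x.val)
    (h1 : ZZ A (s * t)) (h2 : ZZ A (s * u)) (h3 : ZZ A (s ^ 2)) : False := by
  have hsum : ∑ x ∈ A, J (x.val % s = 0 % s) = ((A.filter (fun x => x.val % s = 0 % s)).card : ℤ) := by
    unfold J
    exact_mod_cast sum_boole _ _
  have d0 := c1sq A hs h3 0
  have key : ∀ t : ℕ, t.Prime → s ≠ t → t ∣ A.card → ZZ A (s * t) →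
      t ∣ (A.filter (fun x => x.val % s = 0 % s)).card := by
    intro t ht hst hd hZ
    have := c2 A hs ht hst hZ 0 0
    rw [hsum] at this
    obtain ⟨m, hm⟩ := hd
    rw [hm] at this
    push_cast at this
    have h4 : (t : ℤ) ∣ ((s * (A.filter (fun x => x.val % s = 0 % s)).card : ℕ) : ℤ) := by
      refine ⟨s * ∑ x ∈ A, J (x.val % s = 0 % s) * J (x.val % t = 0 % t)
        - ∑ x ∈ A, J (x.val % t = 0 % t) + m, ?_⟩
      push_cast
      linarith
    have h5 := Int.natCast_dvd_natCast.1 h4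
    rcases (Nat.Prime.dvd_mul ht).1 h5 with h | h
    · exact absurd ((Nat.prime_dvd_prime_iff_eq ht hs).1 h).symm hst
    · exact h
  rw [hsum] at d0
  have d0 := Int.natCast_dvd_natCast.1 d0
  have dt := key t ht hst ⟨s * u, by rw [hA]; ring⟩ h1
  have du := key u hu hsu ⟨s * t, by rw [hA]; ring⟩ h2
  have cst := (Nat.coprime_primes hs ht).2 hst
  have csu := (Nat.coprime_primes hs hu).2 hsu
  have ctu := (Nat.coprime_primes ht hu).2 htu
  have d := Nat.Coprime.mul_dvd_of_dvd_of_dvd (Nat.Coprime.mul_left csu ctu)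
    (Nat.Coprime.mul_dvd_of_dvd_of_dvd cst d0 dt) du
  rw [← hA] at d
  have hpos : 0 < (A.filter (fun x => x.val % s = 0 % s)).card :=
    card_pos.2 ⟨0, mem_filter.2 ⟨h0, by rw [ZMod.val_zero]⟩⟩
  have hlt : (A.filter (fun x => x.val % s = 0 % s)).card < A.card := by
    apply card_lt_card
    rw [filter_ssubset]
    obtain ⟨x, hx, hxs⟩ := hsub
    refine ⟨x, hx, fun h => hxs (Nat.dvd_of_mod_eq_zero (by simpa using h))⟩
  exact absurd (Nat.le_of_dvd hpos d) (by omega)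

lemma case_one {M : ℕ} (B : Finset (ZMod M)) {s t u : ℕ} (hs : s.Prime) (ht : t.Prime)
    (hst : s ≠ t) (hB : B.card = s * t * u) (h1 : ZZ B s)
    (k0 b0 : ℕ) (hx : ∃ x ∈ B, x.val % s = k0 ∧ x.val % t ≠ b0)
    (hall : ∀ x ∈ B, x.val % s ≠ k0 → x.val % t = b0) : ¬ ZZ B (s * t) := by
  intro h
  obtain ⟨x, hx, hxk, hxb⟩ := hx
  have hk0 : k0 < s := by rw [← hxk]; exact Nat.mod_lt _ hs.pos
  obtain ⟨k1, hk1, hk⟩ : ∃ k1 < s, k1 ≠ k0 := by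
    have := hs.two_le
    by_cases h : k0 = 0
    · exact ⟨1, by omega, by omega⟩
    · exact ⟨0, by omega, by omega⟩
  have e0 := c2 B hs ht hst h k0 x.val
  have e1 := c2 B hs ht hst h k1 x.val
  have f0 := c1 B hs h1 k0
  have f1 := c1 B hs h1 k1
  have z1 : ∑ y ∈ B, J (y.val % s = k1 % s) * J (y.val % t = x.val % t) = 0 := by
    apply sum_eq_zero
    intro y hy
    by_cases h : y.val % s = k1
    · have := hall y hy (by omega)
      have : ¬ (y.val % t = x.val % t) := by rw [this]; exact fun h => hxb h.symm
      simp [J, this]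
    · rw [Nat.mod_eq_of_lt hk1]; simp [J, h]
  have z0 : 0 < ∑ y ∈ B, J (y.val % s = k0 % s) * J (y.val % t = x.val % t) := by
    apply sum_pos' 
    · intro y _; unfold J; positivity
    · exact ⟨x, hx, by simp [J, Nat.mod_eq_of_lt hk0, hxk]⟩
  have hs0 : (0 : ℤ) < s := by exact_mod_cast hs.pos
  have ht0 : (0 : ℤ) < t := by exact_mod_cast ht.pos
  have := mul_pos (mul_pos hs0 ht0) z0
  rw [z1] at e1
  linarith

lemma miss {ι : Type*} (E : Finset ι) (v : ι → ℕ) (g : ι → ℤ) {t : ℕ} (ht : t.Prime) (j : ℕ)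
    (hj : j < t) (hm : ∀ x ∈ E, v x % t ≠ j) (h : ∀ c, ∑ x ∈ E, g x * ff t 0 c (v x) = 0) (c : ℕ) :
    ∑ x ∈ E, g x * J (v x % t = c % t) = 0 := by
  have h1 := h j
  have h2 := h c
  have e1 : ∑ x ∈ E, g x * ff t 0 j (v x) = - ∑ x ∈ E, g x := by
    rw [← sum_neg_distrib]
    apply sum_congr rfl
    intro x hx
    simp [ff_zero, J, Nat.mod_eq_of_lt hj, hm x hx]
  have e2 : ∑ x ∈ E, g x * ff t 0 c (v x) = t * ∑ x ∈ E, g x * J (v x % t = c % t) - ∑ x ∈ E, g x := by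
    rw [mul_sum, ← sum_sub_distrib]
    apply sum_congr rfl
    intro x hx
    rw [ff_zero]; ring
  have ht0 : (t : ℤ) ≠ 0 := by exact_mod_cast ht.ne_zero
  have : (t : ℤ) * ∑ x ∈ E, g x * J (v x % t = c % t) = 0 := by linarith
  exact (mul_eq_zero.1 this).resolve_left ht0

lemma third {t : ℕ} (ht : 3 ≤ t) (a b : ℕ) : ∃ j < t, j ≠ a ∧ j ≠ b := by
  by_cases h0 : 0 ≠ a ∧ 0 ≠ b
  · exact ⟨0, by omega, h0⟩
  by_cases h1 : 1 ≠ a ∧ 1 ≠ b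
  · exact ⟨1, by omega, h1⟩
  exact ⟨2, by omega, by omega⟩

/-- the set `A` in the parity case -/
lemma A_part {M : ℕ} (A : Finset (ZMod M)) {t u : ℕ} (ht : t.Prime) (hu : u.Prime) (htu : t ≠ u)
    (h2t : t ≠ 2) (h2u : u ≠ 2) (hA : A.card = 2 * t * u) (h4 : ZZ A (2 ^ 2)) (h1 : ZZ A t)
    (a1 : ZZ A (2 * u)) (a2 : ZZ A (2 * u ^ 2)) (a3 : ZZ A (2 * t * u)) (a4 : ZZ A (2 * t * u ^ 2)) :
    False := by
  have hp2 := Nat.prime_two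
  have ht0 : (t : ℤ) ≠ 0 := by exact_mod_cast ht.ne_zero
  have hu3 : 3 ≤ u := by have := hu.two_le; omega
  set χ : ZMod M → ℤ := fun x => ff 2 0 0 x.val with hχ
  have g1 : ∑ x ∈ A, χ x * ff u 0 0 x.val = 0 := ff2 A hp2 hu h2u.symm 0 0 0 0 (by simpa using a1)
  have g2 : ∑ x ∈ A, χ x * ff u 1 0 x.val = 0 := ff2 A hp2 hu h2u.symm 0 0 1 0 (by simpa using a2)
  have g3 : ∀ j, ∑ x ∈ A, χ x * ff t 0 j x.val * ff u 0 0 x.val = 0 := fun j =>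
    ff3 A hp2 ht hu h2t.symm h2u.symm htu 0 0 0 j 0 0 (by simpa using a3)
  have g4 : ∀ j, ∑ x ∈ A, χ x * ff t 0 j x.val * ff u 1 0 x.val = 0 := fun j =>
    ff3 A hp2 ht hu h2t.symm h2u.symm htu 0 0 0 j 1 0 (by simpa using a4)
  have key : ∀ (w : ZMod M → ℤ) (j : ℕ), ∑ x ∈ A, χ x * w x = 0 →
      ∑ x ∈ A, χ x * ff t 0 j x.val * w x = 0 → ∑ x ∈ A, χ x * J (x.val % t = j % t) * w x = 0 := by
    intro w j h1 h2
    have : (t : ℤ) * ∑ x ∈ A, χ x * J (x.val % t = j % t) * w x = 0 := by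
      have e : ∑ x ∈ A, χ x * ff t 0 j x.val * w x
        = (t : ℤ) * ∑ x ∈ A, χ x * J (x.val % t = j % t) * w x - ∑ x ∈ A, χ x * w x := by
        rw [mul_sum, ← sum_sub_distrib]
        apply sum_congr rfl
        intro x hx
        rw [ff_zero]; ring
      linarith
    exact (mul_eq_zero.1 this).resolve_left ht0
  have hS : ∀ j, ∑ x ∈ A, χ x * J (x.val % t = j % t) = 0 := by
    intro j
    have k1 := key _ j g1 (g3 j)
    have k2 := key _ j g2 (g4 j)
    have e : ∑ x ∈ A, χ x * J (x.val % t = j % t) =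
        (u : ℤ) ^ 2 * ∑ x ∈ A, χ x * J (x.val % t = j % t) * J (x.val % u ^ 2 = 0 % u ^ 2)
        - ∑ x ∈ A, χ x * J (x.val % t = j % t) * ff u 0 0 x.val
        - u * ∑ x ∈ A, χ x * J (x.val % t = j % t) * ff u 1 0 x.val := by
      rw [mul_sum, mul_sum, ← sum_sub_distrib, ← sum_sub_distrib]
      apply sum_congr rfl
      intro x hx
      rw [ff_zero, ff_one]; ring
    rw [k1, k2] at e
    have hd : (u : ℤ) ^ 2 ∣ ∑ x ∈ A, χ x * J (x.val % t = j % t) := ⟨_, by linarith⟩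
    have hN := c1 A ht h1 j
    rw [hA] at hN
    push_cast at hN
    have hN' : ∑ x ∈ A, J (x.val % t = j % t) = 2 * u := by
      apply mul_left_cancel₀ ht0
      linarith
    have habs : |∑ x ∈ A, χ x * J (x.val % t = j % t)| ≤ 2 * u := by
      rw [← hN']
      refine (abs_sum_le_sum_abs _ _).trans (sum_le_sum fun x _ => ?_)
      rw [hχ]
      simp only [ff_zero, J]
      split_ifs <;> simp
    apply Int.eq_zero_of_abs_lt_dvd hd
    have : (3 : ℤ) ≤ u := by exact_mod_cast hu3
    nlinarith
  have hχ0 : ∑ x ∈ A, χ x = 0 := by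
    have : ∑ j ∈ range t, ∑ x ∈ A, χ x * J (x.val % t = j % t) = ∑ x ∈ A, χ x := by
      rw [sum_comm]
      apply sum_congr rfl
      intro x _
      rw [sum_eq_single (x.val % t)]
      · simp [J]
      · intro b hb hne
        rw [Nat.mod_eq_of_lt (mem_range.1 hb)]
        simp [J, hne.symm]
      · intro h; exact absurd (mem_range.2 (Nat.mod_lt _ ht.pos)) h
    rw [← this]
    exact sum_eq_zero fun j _ => hS j
  have e : ∑ x ∈ A, χ x = 2 * ∑ x ∈ A, J (x.val % 2 = 0 % 2) - A.card := by
    rw [card_eq_sum_ones, Nat.cast_sum, mul_sum, ← sum_sub_distrib]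
    apply sum_congr rfl
    intro x _
    rw [hχ]; simp only [ff_zero]; push_cast; ring
  obtain ⟨m, hm⟩ := c1sq A hp2 h4 0
  rw [hm, hχ0, hA] at e
  push_cast at e
  have h5 : 2 * m = ((t * u : ℕ) : ℤ) := by push_cast; linarith
  have ho : Odd (t * u) := (ht.odd_of_ne_two h2t).mul (hu.odd_of_ne_two h2u)
  obtain ⟨l, hl⟩ := ho
  omega

lemma case_two {M : ℕ} (A B : Finset (ZMod M)) {t u : ℕ} (ht : t.Prime) (hu : u.Prime) (htu : t ≠ u)
    (h2t : t ≠ 2) (h2u : u ≠ 2) (hM : M = 2 ^ 2 * t ^ 2 * u ^ 2)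
    (hZ : ∀ n, n ∣ M → n ≠ 1 → ZZ A n ∨ ZZ B n)
    (hA : A.card = 2 * t * u) (hB : B.card = 2 * t * u)
    (hA4 : ZZ A (2 ^ 2)) (hB2 : ZZ B 2)
    (k0 k1 b0 b1 c0 c1' : ℕ) (hk : k0 ≠ k1) (hb : b0 ≠ b1) (hc : c0 ≠ c1')
    (hy : ∃ x ∈ B, x.val % 2 = k1 ∧ x.val % t = b0 ∧ x.val % u = c0)
    (hw : ∃ x ∈ B, x.val % 2 = k1 ∧ x.val % t = b1 ∧ x.val % u = c1')
    (hall : ∀ x ∈ B, (x.val % 2 = k1 ∧ x.val % t = b0 ∧ x.val % u = c0) ∨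
      (x.val % 2 = k1 ∧ x.val % t = b1 ∧ x.val % u = c1') ∨
      (x.val % 2 = k0 ∧ x.val % t = b0 ∧ x.val % u = c1') ∨
      (x.val % 2 = k0 ∧ x.val % t = b1 ∧ x.val % u = c0))
    (hB2t : ZZ B (2 * t)) : False := by
  have hp2 := Nat.prime_two
  have ht3 : 3 ≤ t := by have := ht.two_le; omega
  have hu3 : 3 ≤ u := by have := hu.two_le; omega
  obtain ⟨jt, hjt, hjt0, hjt1⟩ := third ht3 b0 b1
  obtain ⟨ju, hju, hju0, hju1⟩ := third hu3 c0 c1'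
  have mt : ∀ x ∈ B, x.val % t ≠ jt := fun x hx => by rcases hall x hx with h | h | h | h <;> omega
  have mu : ∀ x ∈ B, x.val % u ≠ ju := fun x hx => by rcases hall x hx with h | h | h | h <;> omega
  have hb0 : b0 % t = b0 := by obtain ⟨x, _, _, h, _⟩ := hy; rw [← h, Nat.mod_mod]
  have hc0 : c0 % u = c0 := by obtain ⟨x, _, _, _, h⟩ := hy; rw [← h, Nat.mod_mod]
  have hk1 : k1 % 2 = k1 := by obtain ⟨x, _, h, _, _⟩ := hy; rw [← h, Nat.mod_mod]
  set Y : ZMod M → ℤ := fun x => J (x.val % 2 = k1 ∧ x.val % t = b0 ∧ x.val % u = c0) with hY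
  set W : ZMod M → ℤ := fun x => J (x.val % 2 = k1 ∧ x.val % t = b1 ∧ x.val % u = c1') with hW
  set V : ZMod M → ℤ := fun x => J (x.val % 2 = k0 ∧ x.val % t = b0 ∧ x.val % u = c1') with hV
  set U : ZMod M → ℤ := fun x => J (x.val % 2 = k0 ∧ x.val % t = b1 ∧ x.val % u = c0) with hU
  set χ : ZMod M → ℤ := fun x => ff 2 0 k1 x.val with hχ
  have hYpos : 0 < ∑ x ∈ B, Y x := by
    obtain ⟨x, hx, h⟩ := hy
    exact sum_pos' (fun y _ => by rw [hY]; simp only [J]; positivity) ⟨x, hx, by simp [hY, J, h]⟩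
  have hWpos : 0 < ∑ x ∈ B, W x := by
    obtain ⟨x, hx, h⟩ := hw
    exact sum_pos' (fun y _ => by rw [hW]; simp only [J]; positivity) ⟨x, hx, by simp [hW, J, h]⟩
  have s1 : ∑ x ∈ B, J (x.val % 2 = k1 % 2) = ∑ x ∈ B, Y x + ∑ x ∈ B, W x := by
    rw [← sum_add_distrib]
    refine sum_congr rfl fun x hx => ?_
    rcases hall x hx with ⟨h1, h2, h3⟩ | ⟨h1, h2, h3⟩ | ⟨h1, h2, h3⟩ | ⟨h1, h2, h3⟩ <;>
      simp [J, hY, hW, h1, h2, h3, hk1, hk, hb, hc, hb.symm, hc.symm]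
  have s1' : (B.card : ℤ) = ∑ x ∈ B, Y x + ∑ x ∈ B, W x + ∑ x ∈ B, V x + ∑ x ∈ B, U x := by
    rw [card_eq_sum_ones, Nat.cast_sum, ← sum_add_distrib, ← sum_add_distrib, ← sum_add_distrib]
    refine sum_congr rfl fun x hx => ?_
    rcases hall x hx with ⟨h1, h2, h3⟩ | ⟨h1, h2, h3⟩ | ⟨h1, h2, h3⟩ | ⟨h1, h2, h3⟩ <;>
      simp [J, hY, hW, hU, hV, h1, h2, h3, hk1, hk, hb, hc, hk.symm, hb.symm, hc.symm]
  have s2 : ∑ x ∈ B, J (x.val % t = b0 % t) = ∑ x ∈ B, Y x + ∑ x ∈ B, V x := by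
    rw [← sum_add_distrib]
    refine sum_congr rfl fun x hx => ?_
    rcases hall x hx with ⟨h1, h2, h3⟩ | ⟨h1, h2, h3⟩ | ⟨h1, h2, h3⟩ | ⟨h1, h2, h3⟩ <;>
      simp [J, hY, hV, h1, h2, h3, hb0, hk, hb, hc, hk.symm, hb.symm, hc.symm]
  have s3 : ∑ x ∈ B, χ x * J (x.val % t = b0 % t) = ∑ x ∈ B, Y x - ∑ x ∈ B, V x := by
    rw [← sum_sub_distrib]
    refine sum_congr rfl fun x hx => ?_
    rcases hall x hx with ⟨h1, h2, h3⟩ | ⟨h1, h2, h3⟩ | ⟨h1, h2, h3⟩ | ⟨h1, h2, h3⟩ <;>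
      simp [J, hχ, ff_zero, hY, hV, h1, h2, h3, hk1, hb0, hk, hb, hc, hk.symm, hb.symm, hc.symm]
  have s4 : ∑ x ∈ B, χ x * J (x.val % u = c0 % u) = ∑ x ∈ B, Y x - ∑ x ∈ B, U x := by
    rw [← sum_sub_distrib]
    refine sum_congr rfl fun x hx => ?_
    rcases hall x hx with ⟨h1, h2, h3⟩ | ⟨h1, h2, h3⟩ | ⟨h1, h2, h3⟩ | ⟨h1, h2, h3⟩ <;>
      simp [J, hχ, ff_zero, hY, hU, h1, h2, h3, hk1, hc0, hk, hb, hc, hk.symm, hb.symm, hc.symm]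
  have s5 : ∑ x ∈ B, χ x * J (x.val % t = b0 % t) * J (x.val % u = c0 % u) = ∑ x ∈ B, Y x := by
    refine sum_congr rfl fun x hx => ?_
    rcases hall x hx with ⟨h1, h2, h3⟩ | ⟨h1, h2, h3⟩ | ⟨h1, h2, h3⟩ | ⟨h1, h2, h3⟩ <;>
      simp [J, hχ, ff_zero, hY, h1, h2, h3, hk1, hc0, hb0, hk, hb, hc, hk.symm, hb.symm, hc.symm]
  -- basic counts
  have n1 := c1 B hp2 hB2 k1
  rw [s1, hB] at n1
  rw [hB] at s1'
  push_cast at n1 s1'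
  have n2 : ∑ x ∈ B, Y x = ∑ x ∈ B, V x := by
    have := miss B ZMod.val χ ht jt hjt mt
      (fun c => ff2 B hp2 ht h2t.symm 0 k1 0 c (by simpa using hB2t)) b0
    rw [s3] at this
    linarith
  -- `t` divides `Y`
  have nBt : ¬ ZZ B t := by
    intro h
    have := c1 B ht h jt
    rw [sum_eq_zero, mul_zero, hB] at this
    · have h1 : 2 * t * u = 0 := by exact_mod_cast this.symm
      have := Nat.mul_pos (Nat.mul_pos (by norm_num : 0 < 2) ht.pos) hu.pos
      omega
    · intro x hx
      simp [J, Nat.mod_eq_of_lt hjt, mt x hx]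
  have hAt : ZZ A t := (hZ t ⟨2 ^ 2 * t * u ^ 2, by rw [hM]; ring⟩ ht.one_lt.ne').resolve_right nBt
  have hBt2 : ZZ B (t ^ 2) := by
    refine (hZ (t ^ 2) ⟨2 ^ 2 * u ^ 2, by rw [hM]; ring⟩
      (by have := ht.two_le; nlinarith)).resolve_left fun h => ?_
    exact not_both A ht hp2 hu h2t htu (by rw [hA]; ring) hAt h
  have tY : (t : ℤ) ∣ ∑ x ∈ B, Y x := by
    have := c1sq B ht hBt2 b0
    rw [s2, ← n2, ← two_mul] at this
    refine IsCoprime.dvd_of_dvd_mul_left ?_ this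
    exact Nat.isCoprime_iff_coprime.2 ((Nat.coprime_primes ht hp2).2 h2t)
  -- `u` does not divide `Y`
  have uY : ¬ (u : ℤ) ∣ ∑ x ∈ B, Y x := by
    intro h
    have := IsCoprime.mul_dvd (Nat.isCoprime_iff_coprime.2 ((Nat.coprime_primes ht hu).2 htu)) tY h
    have := Int.le_of_dvd hYpos this
    linarith
  have cu2 : IsCoprime (u : ℤ) 2 :=
    Nat.isCoprime_iff_coprime.2 ((Nat.coprime_primes hu hp2).2 h2u)
  have YU : ∑ x ∈ B, U x = t * u - ∑ x ∈ B, Y x := by linarith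
  have q1 : ¬ ZZ B (2 * u) := by
    intro h
    have := miss B ZMod.val χ hu ju hju mu
      (fun c => ff2 B hp2 hu h2u.symm 0 k1 0 c (by simpa using h)) c0
    rw [s4] at this
    apply uY
    refine IsCoprime.dvd_of_dvd_mul_left cu2 ⟨t, ?_⟩
    linarith
  have q2 : ¬ ZZ B (2 * u ^ 2) := by
    intro h
    have := ff2 B hp2 hu h2u.symm 0 k1 1 c0 (by simpa using h)
    have e : ∑ x ∈ B, ff 2 0 k1 x.val * ff u 1 c0 x.val =
      u * ∑ x ∈ B, χ x * J (x.val % u ^ 2 = c0 % u ^ 2) - ∑ x ∈ B, χ x * J (x.val % u = c0 % u) := by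
      rw [mul_sum, ← sum_sub_distrib]
      refine sum_congr rfl fun x hx => ?_
      rw [ff_one]; ring
    rw [e, s4, YU] at this
    apply uY
    refine IsCoprime.dvd_of_dvd_mul_left cu2
      ⟨∑ x ∈ B, χ x * J (x.val % u ^ 2 = c0 % u ^ 2) + t, ?_⟩
    linarith
  have q3 : ¬ ZZ B (2 * t * u) := by
    intro h
    have a : ∀ c, ∑ x ∈ B, χ x * ff u 0 c x.val * J (x.val % t = b0 % t) = 0 := fun c =>
      miss B ZMod.val (fun x => χ x * ff u 0 c x.val) ht jt hjt mt (fun d => by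
        rw [← ff3 B hp2 ht hu h2t.symm h2u.symm htu 0 k1 0 d 0 c (by simpa using h)]
        exact sum_congr rfl fun x _ => by ring) b0
    have := miss B ZMod.val (fun x => χ x * J (x.val % t = b0 % t)) hu ju hju mu (fun c => by
        rw [← a c]
        exact sum_congr rfl fun x _ => by ring) c0
    rw [s5] at this
    omega
  have q4 : ¬ ZZ B (2 * t * u ^ 2) := by
    intro h
    have a : ∑ x ∈ B, χ x * ff u 1 c0 x.val * J (x.val % t = b0 % t) = 0 := 
      miss B ZMod.val (fun x => χ x * ff u 1 c0 x.val) ht jt hjt mt (fun d => by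
        rw [← ff3 B hp2 ht hu h2t.symm h2u.symm htu 0 k1 0 d 1 c0 (by simpa using h)]
        exact sum_congr rfl fun x _ => by ring) b0
    have e : ∑ x ∈ B, χ x * ff u 1 c0 x.val * J (x.val % t = b0 % t) =
      u * ∑ x ∈ B, χ x * J (x.val % t = b0 % t) * J (x.val % u ^ 2 = c0 % u ^ 2)
      - ∑ x ∈ B, χ x * J (x.val % t = b0 % t) * J (x.val % u = c0 % u) := by
      rw [mul_sum, ← sum_sub_distrib]
      refine sum_congr rfl fun x hx => ?_
      rw [ff_one]; ring
    rw [e, s5] at a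
    exact uY ⟨_, (sub_eq_zero.1 a).symm⟩
  have ne1 : ∀ m : ℕ, 2 * m ≠ 1 := by omega
  refine A_part A ht hu htu h2t h2u hA hA4 hAt
    ((hZ _ ⟨2 * t ^ 2 * u, by rw [hM]; ring⟩ (ne1 _)).resolve_right q1)
    ((hZ _ ⟨2 * t ^ 2, by rw [hM]; ring⟩ (ne1 _)).resolve_right q2)
    ((hZ _ ⟨2 * t * u, by rw [hM]; ring⟩ (by rw [mul_assoc]; exact ne1 _)).resolve_right q3)
    ((hZ _ ⟨2 * t, by rw [hM]; ring⟩ (by rw [mul_assoc]; exact ne1 _)).resolve_right q4)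

lemma core {M : ℕ} (A B : Finset (ZMod M)) {s t u : ℕ} (hs : s.Prime) (ht : t.Prime) (hu : u.Prime)
    (hst : s ≠ t) (hsu : s ≠ u) (htu : t ≠ u) (hM : M = s ^ 2 * t ^ 2 * u ^ 2)
    (hZ : ∀ n, n ∣ M → n ≠ 1 → ZZ A n ∨ ZZ B n)
    (hA : A.card = s * t * u) (hB : B.card = s * t * u)
    (h0A : (0 : ZMod M) ∈ A) (h0B : (0 : ZMod M) ∈ B)
    (hApr : NotInProperSubgroup A) (hBpr : NotInProperSubgroup B)
    (hint : ∀ x ∈ B, ∀ y ∈ B, x.val % s = y.val % s ∨ x.val % t = y.val % t ∨ x.val % u = y.val % u) :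
    ZZ A s := by
  refine (hZ s ⟨s * t ^ 2 * u ^ 2, by rw [hM]; ring⟩ hs.one_lt.ne').resolve_right fun hBs => ?_
  have hAs2 : ZZ A (s ^ 2) := by
    refine (hZ (s ^ 2) ⟨t ^ 2 * u ^ 2, by rw [hM]; ring⟩
      (by have := hs.two_le; nlinarith)).resolve_right fun h => ?_
    exact not_both B hs ht hu hst hsu hB hBs h
  have ds : s ∣ M := ⟨s * t ^ 2 * u ^ 2, by rw [hM]; ring⟩
  have dt : t ∣ M := ⟨s ^ 2 * t * u ^ 2, by rw [hM]; ring⟩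
  have du : u ∣ M := ⟨s ^ 2 * t ^ 2 * u, by rw [hM]; ring⟩
  have nonc : ∀ d, d ∣ M → 1 < d → ∀ c, ∃ x ∈ B, x.val % d ≠ c := by
    intro d hd hd1 c
    obtain ⟨x, hx, h⟩ := hBpr d hd hd1
    by_cases hc : c = 0
    · exact ⟨x, hx, fun h' => h (Nat.dvd_of_mod_eq_zero (h'.trans hc))⟩
    · exact ⟨0, h0B, by simpa using Ne.symm hc⟩
  have fin := fin_lem A hs ht hu hst hsu htu hA h0A (hApr s ds hs.one_lt)
  have ne1 : ∀ m : ℕ, s * m ≠ 1 := fun m h => hs.one_lt.ne' (Nat.eq_one_of_mul_eq_one_right h)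
  have dst : s * t ∣ M := ⟨s * t * u ^ 2, by rw [hM]; ring⟩
  have dsu : s * u ∣ M := ⟨s * t ^ 2 * u, by rw [hM]; ring⟩
  rcases comb B (fun x => x.val % s) (fun x => x.val % t) (fun x => x.val % u) hint
    (nonc s ds hs.one_lt) (nonc t dt ht.one_lt) (nonc u du hu.one_lt) with
    ⟨k0, b0, c0, h1, h2, h3⟩ | ⟨k0, k1, b0, b1, c0, c1', n1, n2, n3, w1, w2, h⟩
  · refine fin ((hZ _ dst (ne1 _)).resolve_right ?_) ((hZ _ dsu (ne1 _)).resolve_right ?_) hAs2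
    · exact case_one B hs ht hst hB hBs k0 b0 h1 (fun x hx hk => (h3 x hx hk).1)
    · exact case_one B (u := t) hs hu hsu (by rw [hB]; ring) hBs k0 c0 h2
        (fun x hx hk => (h3 x hx hk).2)
  · have hs2 : s = 2 := by
      by_contra hne
      have hs3 : 3 ≤ s := by have := hs.two_le; omega
      obtain ⟨j, hj, hj0, hj1⟩ := third hs3 k0 k1
      have := c1 B hs hBs j
      rw [sum_eq_zero, mul_zero, hB] at this
      · have h1 : s * t * u = 0 := by exact_mod_cast this.symm
        have := Nat.mul_pos (Nat.mul_pos hs.pos ht.pos) hu.pos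
        omega
      · intro x hx
        have : x.val % s ≠ j := by rcases h x hx with h | h | h | h <;> omega
        simp [J, Nat.mod_eq_of_lt hj, this]
    subst hs2
    refine fin ((hZ _ dst (ne1 _)).resolve_right fun hz => ?_)
      ((hZ _ dsu (ne1 _)).resolve_right fun hz => ?_) hAs2
    · exact case_two A B ht hu htu hst.symm hsu.symm hM hZ hA hB hAs2 hBs k0 k1 b0 b1 c0 c1' n1 n2 n3
        w1 w2 h hz
    · refine case_two A B hu ht htu.symm hsu.symm hst.symm (by rw [hM]; ring) hZ (by rw [hA]; ring)
        (by rw [hB]; ring) hAs2 hBs k0 k1 c0 c1' b0 b1 n1 n3 n2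
        ?_ ?_ ?_ hz
      · obtain ⟨x, hx, h⟩ := w1; exact ⟨x, hx, by tauto⟩
      · obtain ⟨x, hx, h⟩ := w2; exact ⟨x, hx, by tauto⟩
      · intro x hx; have := h x hx; tauto

lemma mod_of_dvd_sub {M : ℕ} [NeZero M] {d : ℕ} (hd : d ∣ M) (x y : ZMod M) (h : d ∣ (x - y).val) :
    x.val % d = y.val % d := by
  have h1 : x.val = (x - y + y).val := by rw [sub_add_cancel]
  rw [h1, ZMod.val_add, Nat.mod_mod_of_dvd _ hd, Nat.add_mod, Nat.mod_eq_zero_of_dvd h]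
  simp

/-- Proposition 2.9(i): `Φ_p(x)·Φ_q(x)·Φ_r(x) ∣ A(x)`. -/
theorem stmt_16 (p q r M : ℕ) (hp : p.Prime) (hq : q.Prime) (hr : r.Prime)
    (hpq : p < q) (hqr : q < r) (hM : M = p ^ 2 * q ^ 2 * r ^ 2)
    (A B : Finset (ZMod M)) (hT : Tiles A B)
    (hA : A.card = p * q * r) (hB : B.card = p * q * r)
    (h0A : (0 : ZMod M) ∈ A) (h0B : (0 : ZMod M) ∈ B)
    (hApr : NotInProperSubgroup A) (hBpr : NotInProperSubgroup B)
    (hone : 1 ∉ DivSet B) :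
    cyclotomic p ℤ * cyclotomic q ℤ * cyclotomic r ℤ ∣ maskPoly A := by
  have hM0 : 0 < M := by
    rw [hM]; have := hp.pos; have := hq.pos; have := hr.pos; positivity
  have : NeZero M := ⟨hM0.ne'⟩
  have hZ := tile_or hM0 A B hT
  have hint : ∀ x ∈ B, ∀ y ∈ B,
      x.val % p = y.val % p ∨ x.val % q = y.val % q ∨ x.val % r = y.val % r := by
    intro x hx y hy
    have h1 : Nat.gcd ((x - y).val) M ≠ 1 := fun h => hone ⟨x, hx, y, hy, h⟩
    obtain ⟨l, hl, hld⟩ := Nat.exists_prime_and_dvd h1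
    have hlx := hld.trans (Nat.gcd_dvd_left _ _)
    have hlM := hld.trans (Nat.gcd_dvd_right _ _)
    have hh := mod_of_dvd_sub hlM x y hlx
    rw [hM] at hlM
    rcases (Nat.Prime.dvd_mul hl).1 hlM with h | h
    · rcases (Nat.Prime.dvd_mul hl).1 h with h | h
      · rw [(Nat.prime_dvd_prime_iff_eq hl hp).1 (hl.dvd_of_dvd_pow h)] at hh; exact Or.inl hh
      · rw [(Nat.prime_dvd_prime_iff_eq hl hq).1 (hl.dvd_of_dvd_pow h)] at hh
        exact Or.inr (Or.inl hh)
    · rw [(Nat.prime_dvd_prime_iff_eq hl hr).1 (hl.dvd_of_dvd_pow h)] at hh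
      exact Or.inr (Or.inr hh)
  have hpr : p < r := hpq.trans hqr
  have zp : ZZ A p := core A B hp hq hr hpq.ne hpr.ne hqr.ne hM hZ hA hB h0A h0B hApr hBpr hint
  have zq : ZZ A q := core A B hq hp hr hpq.ne' hqr.ne hpr.ne (by rw [hM]; ring) hZ
    (by rw [hA]; ring) (by rw [hB]; ring) h0A h0B hApr hBpr
    (fun x hx y hy => by have := hint x hx y hy; tauto)
  have zr : ZZ A r := core A B hr hp hq hpr.ne' hqr.ne' hpq.ne (by rw [hM]; ring) hZ
    (by rw [hA]; ring) (by rw [hB]; ring) h0A h0B hApr hBpr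
    (fun x hx y hy => by have := hint x hx y hy; tauto)
  have dv : ∀ n : ℕ, 0 < n → ZZ A n → cyclotomic n ℤ ∣ maskPoly A := fun n hn h =>
    cyc_dvd A hn (Complex.isPrimitiveRoot_exp n hn.ne') (h _ (Complex.isPrimitiveRoot_exp n hn.ne'))
  have rp : ∀ m n : ℕ, 0 < m → 0 < n → m ≠ n → IsRelPrime (cyclotomic m ℤ) (cyclotomic n ℤ) := by
    intro m n hm hn hmn
    rw [(cyclotomic.irreducible hm).isRelPrime_iff_not_dvd]
    intro hd
    have h1 := (cyclotomic.irreducible hm).associated_of_dvd (cyclotomic.irreducible hn) hd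
    exact hmn (cyclotomic_injective
      (Polynomial.eq_of_monic_of_associated (cyclotomic.monic m ℤ) (cyclotomic.monic n ℤ) h1))
  exact IsRelPrime.mul_dvd (IsRelPrime.mul_left (rp p r hp.pos hr.pos hpr.ne)
    (rp q r hq.pos hr.pos hqr.ne)) (IsRelPrime.mul_dvd (rp p q hp.pos hq.pos hpq.ne)
    (dv p hp.pos zp) (dv q hq.pos zq)) (dv r hr.pos zr)
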